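/- Let n ≥ 1 and d be integers with |d| ≥ 2, let v ∈ ℤ/n have d-type [f, e], and assume d^f·v ≠ 0 in ℤ/n (equivalently, 0 does not lie in the orbit of v under multiplication by d). Then the class of e_v in the sand dune group Σ(n,d) has order |d^f·(d^e − 1)|. -/

import Mathlib

open Finset

noncomputable section

/-- The ring `ℤ[x]/(x^n - 1)`, realized as the group algebra `ℤ[ℤ/n]`;
the class of `x^j` (for `j : ℤ`) corresponds to `xp n (j : ZMod n)`. -/
abbrev Rn (n : ℕ) : Type := AddMonoidAlgebra ℤ (ZMod n)

/-- The class of `x^w` in `ℤ[x]/(x^n - 1)`. -/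
def xp (n : ℕ) (w : ZMod n) : Rn n := AddMonoidAlgebra.single w 1

/-- `e_v = x^v - 1`. -/
def eV (n : ℕ) (w : ZMod n) : Rn n := xp n w - 1

/-- `ε_v = d·e_v - e_{d·v}`. -/
def epsV (n : ℕ) (d : ℤ) (w : ZMod n) : Rn n := d • eV n w - eV n ((d : ZMod n) * w)

/-- `𝒵_n`, the ℤ-span of the `e_v`, `1 ≤ v ≤ n-1`. -/
def ZSpan (n : ℕ) : Submodule ℤ (Rn n) :=
  Submodule.span ℤ {a : Rn n | ∃ v : ℤ, 1 ≤ v ∧ v ≤ (n : ℤ) - 1 ∧ a = eV n (v : ZMod n)}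

/-- `ℰ_{n,d}`, the ℤ-span of the `ε_v`, `1 ≤ v ≤ n-1`. -/
def ESpan (n : ℕ) (d : ℤ) : Submodule ℤ (Rn n) :=
  Submodule.span ℤ {a : Rn n | ∃ v : ℤ, 1 ≤ v ∧ v ≤ (n : ℤ) - 1 ∧ a = epsV n d (v : ZMod n)}

/-- `1 + x + ⋯ + x^{|d|-1}`. -/
def geomT (n : ℕ) (d : ℤ) : Rn n := ∑ i ∈ Finset.range d.natAbs, xp n (i : ZMod n)

/-- `f_v`: the Laplacian row polynomial of `DB(n,d)` (for `d ≥ 0`) resp. of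
`Ktz(n,|d|)` (for `d < 0`). -/
def fV (n : ℕ) (d : ℤ) (v : ℤ) : Rn n :=
  if 0 ≤ d then d • xp n ((v : ZMod n)) - xp n (((d * v : ℤ) : ZMod n)) * geomT n d
  else d • xp n ((v : ZMod n)) + xp n (((d * (v + 1) : ℤ) : ZMod n)) * geomT n d

/-- `F_{n,d}`, the ℤ-span of the `f_v`, `1 ≤ v ≤ n-1`. -/
def FSpan (n : ℕ) (d : ℤ) : Submodule ℤ (Rn n) :=
  Submodule.span ℤ {a : Rn n | ∃ v : ℤ, 1 ≤ v ∧ v ≤ (n : ℤ) - 1 ∧ a = fV n d v}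

/-- The sand dune group `Σ(n,d) = 𝒵_n / ℰ_{n,d}`. -/
abbrev SandDune (n : ℕ) (d : ℤ) :=
  ZSpan n ⧸ Submodule.comap (ZSpan n).subtype (ESpan n d)

/-- The sandpile (critical) group `S(n,d) = 𝒵_n / F_{n,d}`. -/
abbrev Sandpile (n : ℕ) (d : ℤ) :=
  ZSpan n ⧸ Submodule.comap (ZSpan n).subtype (FSpan n d)

/-- `v` has `d`-type `[f, e]` in `ℤ/n`: `e ≥ 1`, the elements `d^i·v` for
`0 ≤ i ≤ e+f−1` are pairwise distinct, and `d^{e+f}·v = d^f·v`. -/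
def HasDType (n : ℕ) (d : ℤ) (v : ZMod n) (f e : ℕ) : Prop :=
  1 ≤ e ∧
  (∀ i j : ℕ, i < e + f → j < e + f →
    (d : ZMod n) ^ i * v = (d : ZMod n) ^ j * v → i = j) ∧
  (d : ZMod n) ^ (e + f) * v = (d : ZMod n) ^ f * v

lemma eV_zero (n : ℕ) : eV n 0 = 0 := by
  simp [eV, xp, AddMonoidAlgebra.one_def]

lemma epsV_mem_ESpan {n : ℕ} (hn : 1 ≤ n) (d : ℤ) (w : ZMod n) : epsV n d w ∈ ESpan n d := by
  have : NeZero n := ⟨by omega⟩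
  by_cases hw : w = 0
  · simp [hw, epsV, eV_zero]
  · have hpos : w.val ≠ 0 := by simpa [ZMod.val_eq_zero] using hw
    have hlt := ZMod.val_lt w
    exact Submodule.subset_span ⟨w.val, by omega, by omega, by simp⟩

lemma pow_smul_eV_sub_mem_ESpan {n : ℕ} (hn : 1 ≤ n) (d : ℤ) (w : ZMod n) (k : ℕ) :
    d ^ k • eV n w - eV n ((d : ZMod n) ^ k * w) ∈ ESpan n d := by
  induction k with
  | zero => simp
  | succ k ih =>
    have := add_mem (Submodule.smul_mem _ d ih)
      (epsV_mem_ESpan hn d ((d : ZMod n) ^ k * w))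
    convert this using 1
    simp only [epsV, pow_succ', mul_assoc, mul_smul, smul_sub]
    abel

/-- A bounded function `h` on a set with a self-map `T` is a twisted coboundary
`d * g - g ∘ T`, for `1 < |d|`. -/
lemma exists_mul_eq_add_comp {α : Type*} (T : α → α) {d : ℝ} (hd : 1 < |d|) (h : α → ℝ)
    {C : ℝ} (hC : ∀ a, |h a| ≤ C) : ∃ g : α → ℝ, ∀ a, d * g a = h a + g (T a) := by
  have hd0 : d ≠ 0 := by
    rintro rfl
    norm_num at hd
  have hr : |d⁻¹| < 1 := by
    rw [abs_inv]
    exact inv_lt_one_of_one_lt₀ hd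
  have hs (a : α) : Summable fun j : ℕ => h (T^[j] a) * d⁻¹ ^ j := by
    refine Summable.of_norm_bounded ((summable_geometric_of_abs_lt_one
      (r := |d⁻¹|) (by rwa [abs_abs])).mul_left C) fun j => ?_
    rw [Real.norm_eq_abs, abs_mul, abs_pow]
    exact mul_le_mul_of_nonneg_right (hC _) (by positivity)
  refine ⟨fun a => d⁻¹ * ∑' j : ℕ, h (T^[j] a) * d⁻¹ ^ j, fun a => ?_⟩
  beta_reduce
  rw [mul_inv_cancel_left₀ hd0, (hs a).tsum_eq_zero_add, ← tsum_mul_left]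
  simp only [Function.iterate_zero, id_eq, pow_zero, mul_one, Function.iterate_succ_apply]
  congr 2
  ext j
  ring

/-- The additive map on `R_n` sending `x^w` to `g w`. -/
def evalHom (n : ℕ) (g : ZMod n → ℝ) : Rn n →+ ℝ :=
  AddMonoidAlgebra.liftNC (Int.castAddHom ℝ) fun w => g w.toAdd

lemma evalHom_eV (n : ℕ) (g : ZMod n → ℝ) (w : ZMod n) :
    evalHom n g (eV n w) = g w - g 0 := by
  simp [evalHom, eV, xp, AddMonoidAlgebra.one_def]

lemma evalHom_mem_range_of_mem_ESpan {n : ℕ} {d : ℤ} {g : ZMod n → ℝ} (g0 : g 0 = 0)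
    {h : ZMod n → ℤ} (hg : ∀ w, d * g w = h w + g (d * w)) {a : Rn n} (ha : a ∈ ESpan n d) :
    ∃ m : ℤ, evalHom n g a = m := by
  induction ha using Submodule.span_induction with
  | mem a ha =>
    obtain ⟨v, -, -, rfl⟩ := ha
    refine ⟨h v, ?_⟩
    rw [epsV, map_sub, map_zsmul, evalHom_eV, evalHom_eV, g0, sub_zero, sub_zero,
      zsmul_eq_mul, hg, add_sub_cancel_right]
  | zero => exact ⟨0, by simp⟩
  | add a b _ _ ha hb =>
    obtain ⟨p, hp⟩ := ha
    obtain ⟨q, hq⟩ := hb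
    exact ⟨p + q, by simp [hp, hq]⟩
  | smul c a _ ha =>
    obtain ⟨p, hp⟩ := ha
    exact ⟨c * p, by rw [map_zsmul, hp, zsmul_eq_mul, Int.cast_mul]⟩

/-- A `g` as in `evalHom_mem_range_of_mem_ESpan` whose value at `v` is `1 / (d^f (d^e - 1))`. -/
lemma HasDType.exists_eval {n : ℕ} {d : ℤ} (hd : 2 ≤ |d|) {v : ZMod n} {f e : ℕ}
    (h : HasDType n d v f e) (hv : (d : ZMod n) ^ f * v ≠ 0) :
    ∃ (g : ZMod n → ℝ) (h : ZMod n → ℤ), g 0 = 0 ∧ (∀ w, d * g w = h w + g (d * w)) ∧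
      (d : ℝ) ^ f * (d ^ e - 1) * g v = 1 := by
  classical
  obtain ⟨he, hinj, hper⟩ := h
  obtain ⟨e, rfl⟩ : ∃ e', e = e' + 1 := ⟨e - 1, by omega⟩
  set u : ZMod n := (d : ZMod n) ^ (e + f) * v with hu
  have hdu : (d : ZMod n) * u = (d : ZMod n) ^ f * v := by
    rw [← hper, hu]
    ring
  have hu0 : (0 : ZMod n) ≠ u := by
    intro h0
    rw [← h0, mul_zero] at hdu
    exact hv hdu.symm
  have hd' : (2 : ℝ) ≤ |(d : ℝ)| := by exact_mod_cast hd
  obtain ⟨g, hg⟩ := exists_mul_eq_add_comp (fun w : ZMod n => (d : ZMod n) * w)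
    (d := (d : ℝ)) (by linarith) (fun w => if w = u then 1 else 0) (C := 1)
    (fun w => by split_ifs <;> simp)
  have hpow : ∀ i ≤ e + f, (d : ℝ) ^ i * g v = g ((d : ZMod n) ^ i * v) := by
    intro i
    induction i with
    | zero => simp
    | succ i ih =>
      intro hi
      have hne : (d : ZMod n) ^ i * v ≠ u := fun h => by
        have := hinj i (e + f) (by omega) (by omega) h
        omega
      rw [pow_succ', mul_assoc, ih (by omega), hg, if_neg hne, zero_add, pow_succ', mul_assoc]
  refine ⟨g, fun w => if w = u then 1 else 0, ?_, fun w => by simpa using hg w, ?_⟩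
  · have := hg 0
    simp only [if_neg hu0, mul_zero, zero_add] at this
    have hd1 : (d : ℝ) - 1 ≠ 0 := fun h => by
      rw [sub_eq_zero.mp h] at hd'
      norm_num at hd'
    exact (mul_eq_zero.mp (show ((d : ℝ) - 1) * g 0 = 0 by linarith)).resolve_left hd1
  · have hgu := hg u
    simp only [if_true] at hgu
    rw [hdu, ← hpow f (by omega), hu, ← hpow (e + f) le_rfl] at hgu
    linear_combination hgu

lemma zsmul_eV_mem_ESpan_iff {n : ℕ} (hn : 1 ≤ n) {d : ℤ} (hd : 2 ≤ |d|) {v : ZMod n} {f e : ℕ}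
    (h : HasDType n d v f e) (hv : (d : ZMod n) ^ f * v ≠ 0) (k : ℤ) :
    k • eV n v ∈ ESpan n d ↔ d ^ f * (d ^ e - 1) ∣ k := by
  constructor
  · intro hk
    obtain ⟨g, c, g0, hg, hgv⟩ := h.exists_eval hd hv
    obtain ⟨m, hm⟩ := evalHom_mem_range_of_mem_ESpan g0 hg hk
    rw [map_zsmul, evalHom_eV, g0, sub_zero, zsmul_eq_mul] at hm
    refine ⟨m, ?_⟩
    have : (k : ℝ) = d ^ f * (d ^ e - 1) * m := by
      linear_combination (-(k : ℝ)) * hgv + (d : ℝ) ^ f * (d ^ e - 1) * hm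
    exact_mod_cast this
  · rintro ⟨m, rfl⟩
    rw [mul_comm, mul_smul]
    refine Submodule.smul_mem _ m ?_
    have := sub_mem (pow_smul_eV_sub_mem_ESpan hn d v (e + f))
      (pow_smul_eV_sub_mem_ESpan hn d v f)
    rw [h.2.2, sub_sub_sub_cancel_right, ← sub_smul] at this
    convert this using 2
    ring

/-- if `v ∈ ℤ/n` has `d`-type `[f, e]` and `d^f·v ≠ 0`, then the class
of `e_v` in the sand dune group `Σ(n,d)` has (additive) order `|d^f·(d^e − 1)|`. -/
theorem stmt6 (n : ℕ) (d : ℤ) (hn : 1 ≤ n) (hd : 2 ≤ |d|) (v : ZMod n) (f e : ℕ)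
    (h : HasDType n d v f e) (hv : (d : ZMod n) ^ f * v ≠ 0)
    (hmem : eV n v ∈ ZSpan n) :
    addOrderOf ((Submodule.Quotient.mk ⟨eV n v, hmem⟩ : SandDune n d)) =
      (d ^ f * (d ^ e - 1)).natAbs := by
  have key (k : ℤ) : k • (Submodule.Quotient.mk ⟨eV n v, hmem⟩ : SandDune n d) = 0 ↔
      d ^ f * (d ^ e - 1) ∣ k := by
    rw [← Submodule.Quotient.mk_smul, Submodule.Quotient.mk_eq_zero, Submodule.mem_comap]
    exact zsmul_eV_mem_ESpan_iff hn hd h hv k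
  apply Nat.dvd_antisymm
  · rw [← Int.natCast_dvd_natCast, addOrderOf_dvd_iff_zsmul_eq_zero, key]
    exact Int.dvd_natAbs_self
  · rw [← Int.natCast_dvd_natCast, Int.natAbs_dvd, ← key, natCast_zsmul]
    exact addOrderOf_nsmul_eq_zero _
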